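/- For n ≥ 2 and 1 ≤ i ≤ n−1, there is a short exact sequence of ℂ[S_n]-modules 0 → R_n^{(i)} →^φ R^n_{n−i,i+1} →^ψ R^n_{n−i,i} → 0, where φ is the map induced by the inclusion F^i J_n + F^{i+1} B_n ⊆ I^n_{n−i,i+1} and ψ is the natural quotient map coming from the inclusion of ideals I^n_{n−i,i+1} ⊆ I^n_{n−i,i}. -/

import Mathlib

open MvPolynomial

set_option maxHeartbeats 1000000
set_option synthInstance.maxHeartbeats 400000

noncomputable section

/-- the ideal `(x₁y₁, …, xₙyₙ)`. -/
abbrev Bideal (n : ℕ) : Ideal (MvPolynomial (Fin n ⊕ Fin n) ℂ) :=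
  Ideal.span (Set.range fun i : Fin n => X (Sum.inl i) * X (Sum.inr i))

/-- `B n = ℂ[x₁,…,xₙ,y₁,…,yₙ]/(x₁y₁,…,xₙyₙ)`, the `n`-th tensor power of `ℂ[x,y]/(xy)`.
The variable `x_i` is `X (Sum.inl i)` and `y_i` is `X (Sum.inr i)`. -/
abbrev B (n : ℕ) : Type := MvPolynomial (Fin n ⊕ Fin n) ℂ ⧸ Bideal n

abbrev mkB (n : ℕ) : MvPolynomial (Fin n ⊕ Fin n) ℂ →ₐ[ℂ] B n :=
  Ideal.Quotient.mkₐ ℂ (Bideal n)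

def xv (n : ℕ) (i : Fin n) : B n := mkB n (X (Sum.inl i))
def yv (n : ℕ) (i : Fin n) : B n := mkB n (X (Sum.inr i))

/-- the action of a permutation `σ ∈ Sₙ` on `B n`: `σ·xᵢ = x_{σ i}`, `σ·yᵢ = y_{σ i}`. -/
def permB (n : ℕ) (σ : Equiv.Perm (Fin n)) : B n →ₐ[ℂ] B n :=
  Ideal.Quotient.liftₐ (Bideal n)
    ((mkB n).comp (MvPolynomial.rename (Sum.map ⇑σ ⇑σ)))
    (by
      intro a ha
      have h : Bideal n ≤ RingHom.ker ((mkB n).comp (MvPolynomial.rename (Sum.map ⇑σ ⇑σ))).toRingHom := by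
        rw [Ideal.span_le]
        rintro _ ⟨i, rfl⟩
        simp only [SetLike.mem_coe, RingHom.mem_ker, AlgHom.toRingHom_eq_coe, RingHom.coe_coe,
          AlgHom.comp_apply, map_mul, rename_X, Sum.map_inl, Sum.map_inr]
        rw [← map_mul, Ideal.Quotient.mkₐ_eq_mk, Ideal.Quotient.eq_zero_iff_mem]
        exact Ideal.subset_span ⟨σ i, rfl⟩
      exact h ha)

/-- evaluation at the origin. -/
def ev0 (n : ℕ) : B n →ₐ[ℂ] ℂ :=
  Ideal.Quotient.liftₐ (Bideal n) (aeval fun _ => (0 : ℂ))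
    (by
      intro a ha
      have h : Bideal n ≤ RingHom.ker (aeval (R := ℂ) fun _ : Fin n ⊕ Fin n => (0 : ℂ)).toRingHom := by
        rw [Ideal.span_le]
        rintro _ ⟨i, rfl⟩
        simp [RingHom.mem_ker]
      exact h ha)

/-- `Jₙ`, the ideal of `B n` generated by the `Sₙ`-invariant elements vanishing at the origin. -/
def Jn (n : ℕ) : Ideal (B n) :=
  Ideal.span {p : B n | (∀ σ : Equiv.Perm (Fin n), permB n σ p = p) ∧ ev0 n p = 0}

/-- the symmetric coinvariant algebra `Rₙ = Bₙ/Jₙ`. -/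
abbrev Rn (n : ℕ) : Type := B n ⧸ Jn n

/-- the `k`-th elementary symmetric polynomial `e_k` in the `x` variables. -/
def eX (n k : ℕ) : B n :=
  ∑ S ∈ Finset.powersetCard k (Finset.univ : Finset (Fin n)), ∏ t ∈ S, xv n t

/-- the `k`-th elementary symmetric polynomial `f_k` in the `y` variables. -/
def fY (n k : ℕ) : B n :=
  ∑ S ∈ Finset.powersetCard k (Finset.univ : Finset (Fin n)), ∏ t ∈ S, yv n t

/-- the generating set `S^n_{i,j}` of the ideal `I^n_{i,j}`:
`e₁,…,e_{i−1}`, all `x_I` with `|I| = i`, `f₁,…,f_{j−1}`, all `y_J` with `|J| = j`. -/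
def Sij (n i j : ℕ) : Set (B n) :=
  {p | ∃ k, 1 ≤ k ∧ k < i ∧ p = eX n k} ∪
  {p | ∃ I : Finset (Fin n), I.card = i ∧ p = ∏ t ∈ I, xv n t} ∪
  {p | ∃ k, 1 ≤ k ∧ k < j ∧ p = fY n k} ∪
  {p | ∃ J : Finset (Fin n), J.card = j ∧ p = ∏ t ∈ J, yv n t}

/-- the ideal `I^n_{i,j}`; `R^n_{i,j} = B n ⧸ Iij n i j`. -/
def Iij (n i j : ℕ) : Ideal (B n) := Ideal.span (Sij n i j)

/-- the filtration `F^p Bₙ = Σ_{|J|=p} y_J Bₙ`. -/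
def FB (n p : ℕ) : Ideal (B n) :=
  Ideal.span {b | ∃ J : Finset (Fin n), J.card = p ∧ b = ∏ t ∈ J, yv n t}

/-- the subquotient `K / K'` of two ideals of `B n`, as a `ℂ`-module. -/
abbrev SQ (n : ℕ) (K K' : Ideal (B n)) : Type :=
  ↥(K.restrictScalars ℂ) ⧸
    (Submodule.comap (K.restrictScalars ℂ).subtype (K'.restrictScalars ℂ))

/-- the class in `K / K'` of an element `p ∈ K`. -/
def sqMk (n : ℕ) (K K' : Ideal (B n)) (p : B n) (hp : p ∈ K) : SQ n K K' :=
  Submodule.Quotient.mk ⟨p, hp⟩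

open Polynomial in
/-- A monic polynomial of degree `m` splits over a universal extension of the base ring, and this
extension preserves nonzerodivisors. -/
theorem exists_universal_splitting (m : ℕ) : ∀ (R : Type) [CommRing R] (p : R[X]), p.Monic →
    p.natDegree = m → ∃ (Q : Type) (_ : CommRing Q) (f : R →+* Q) (y : Fin m → Q),
      (∀ r ∈ nonZeroDivisors R, f r ∈ nonZeroDivisors Q) ∧
      p.map f = ∏ j, (Polynomial.X - Polynomial.C (y j)) ∧
      ∀ (S : Type) [CommRing S] (h : R →+* S) (z : Fin m → S),
        p.map h = ∏ j, (Polynomial.X - Polynomial.C (z j)) →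
        ∃ g : Q →+* S, g.comp f = h ∧ ∀ j, g (y j) = z j := by
  induction m with
  | zero =>
    intro R _ p hp hd
    have h1 : p = 1 := hp.natDegree_eq_zero.mp hd
    exact ⟨R, inferInstance, RingHom.id R, Fin.elim0, fun r hr => hr, by simp [h1],
      fun S _ h z _ => ⟨h, by ext; simp, fun j => j.elim0⟩⟩
  | succ m ih =>
    intro R _ p hp hd
    set s : AdjoinRoot p := AdjoinRoot.root p
    have hroot : (p.map (AdjoinRoot.of p)).IsRoot s := AdjoinRoot.isRoot_root p
    obtain ⟨p₁, hp₁⟩ := dvd_iff_isRoot.mpr hroot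
    have hmon : p₁.Monic := (monic_X_sub_C s).of_mul_monic_left (hp₁ ▸ hp.map _)
    have hfree : Module.Free R (AdjoinRoot p) := hp.free_adjoinRoot
    have hR : Nontrivial R := by
      by_contra h
      rw [not_nontrivial_iff_subsingleton] at h
      simp [Subsingleton.elim p 0] at hd
    have hA : Nontrivial (AdjoinRoot p) := Ideal.Quotient.nontrivial_iff.mpr (by
      rw [Ne, Ideal.span_singleton_eq_top]
      intro hu
      rw [hp.eq_one_of_isUnit hu, natDegree_one] at hd
      omega)
    have hdeg : p₁.natDegree = m := by
      have h1 := hp.natDegree_map (AdjoinRoot.of p)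
      rw [hp₁, (monic_X_sub_C s).natDegree_mul hmon, natDegree_X_sub_C, hd] at h1
      omega
    obtain ⟨Q, _, f, y, hf, hsplit, huniv⟩ := ih (AdjoinRoot p) p₁ hmon hdeg
    refine ⟨Q, inferInstance, f.comp (AdjoinRoot.of p), Fin.cons (f s) y, ?_, ?_, ?_⟩
    · intro r hr
      refine hf _ ?_
      have h := Module.Flat.isSMulRegular_of_isRegular (M := AdjoinRoot p)
        (isRegular_iff_mem_nonZeroDivisors.mpr hr)
      exact mem_nonZeroDivisors_iff_right.mpr fun x hx => h.right_eq_zero_of_smul (by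
        rw [Algebra.smul_def, mul_comm]
        exact hx)
    · rw [← Polynomial.map_map, hp₁, Polynomial.map_mul, hsplit, Fin.prod_univ_succ]
      simp
    · intro S _ h z hz
      have hz0 : p.eval₂ h (z 0) = 0 := by
        rw [← Polynomial.eval_map, hz, Fin.prod_univ_succ]
        simp
      set h' : AdjoinRoot p →+* S := AdjoinRoot.lift h (z 0) hz0
      have hcomp : h'.comp (AdjoinRoot.of p) = h := by ext; simp [h']
      have hs : h' s = z 0 := by simp [h', s]
      obtain ⟨g, hg, hgy⟩ := huniv S h' (fun j => z j.succ) (by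
        apply (monic_X_sub_C (z 0)).isRegular.left
        have h2 := congrArg (Polynomial.map h') hp₁
        rw [Polynomial.map_map, hcomp, hz, Fin.prod_univ_succ] at h2
        simpa [hs] using h2.symm)
      refine ⟨g, by rw [← RingHom.comp_assoc, hg, hcomp], fun j => ?_⟩
      refine Fin.cases ?_ (fun j => ?_) j
      · simp only [Fin.cons_zero]
        rw [← hs, ← hg]; rfl
      · simpa using hgy j

open Polynomial in
theorem coeff_prod_X_sub_C_eq_esymm {σ S : Type*} [Fintype σ] [CommRing S] (z : σ → S) {k : ℕ}
    (hk : k ≤ Fintype.card σ) :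
    (∏ t, (Polynomial.X - Polynomial.C (z t))).coeff (Fintype.card σ - k) =
      (-1) ^ k * MvPolynomial.aeval z (MvPolynomial.esymm σ ℤ k) := by
  rw [MvPolynomial.aeval_esymm_eq_multiset_esymm]
  have h := Multiset.prod_X_sub_C_coeff (Finset.univ.val.map z) (k := Fintype.card σ - k) (by simp)
  rw [Multiset.map_map, Multiset.card_map] at h
  have h2 : (Finset.univ : Finset σ).val.card - (Fintype.card σ - k) = k := by
    change (Finset.univ : Finset σ).card - (Fintype.card σ - k) = k
    rw [Finset.card_univ]
    omega
  rw [h2] at h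
  exact h

open Polynomial in
theorem prod_X_sub_C_of_esymm_eq_zero {σ S : Type*} [Fintype σ] [CommRing S] (z : σ → S)
    (hσ : 0 < Fintype.card σ)
    (h : ∀ k, 1 ≤ k → k < Fintype.card σ → MvPolynomial.aeval z (MvPolynomial.esymm σ ℤ k) = 0) :
    ∏ t, (Polynomial.X - Polynomial.C (z t)) =
      Polynomial.X ^ Fintype.card σ + Polynomial.C ((-1) ^ Fintype.card σ * ∏ t, z t) := by
  nontriviality S
  have hmon : (∏ t, (Polynomial.X - Polynomial.C (z t))).Monic :=
    monic_prod_of_monic _ _ fun t _ => monic_X_sub_C _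
  have hdeg : (∏ t, (Polynomial.X - Polynomial.C (z t))).natDegree = Fintype.card σ := by
    rw [natDegree_prod_of_monic _ _ fun t _ => monic_X_sub_C _]
    simp
  ext j
  rcases lt_trichotomy j (Fintype.card σ) with hj | rfl | hj
  · rcases Nat.eq_zero_or_pos j with rfl | hj0
    · simp [coeff_zero_eq_eval_zero, Polynomial.eval_prod, hσ.ne', Finset.prod_neg]
    · have h1 := coeff_prod_X_sub_C_eq_esymm z (k := Fintype.card σ - j) (by omega)
      rw [h _ (by omega) (by omega), mul_zero, Nat.sub_sub_self hj.le] at h1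
      rw [h1, Polynomial.coeff_add, Polynomial.coeff_X_pow, Polynomial.coeff_C, if_neg hj.ne, if_neg hj0.ne', add_zero]
  · have h1 := hmon.coeff_natDegree
    rw [hdeg] at h1
    rw [h1, Polynomial.coeff_add, Polynomial.coeff_X_pow, Polynomial.coeff_C, if_pos rfl, if_neg hσ.ne', add_zero]
  · rw [coeff_eq_zero_of_natDegree_lt (by omega), Polynomial.coeff_add, Polynomial.coeff_X_pow,
      Polynomial.coeff_C, if_neg hj.ne', if_neg (by omega), add_zero]

theorem MvPolynomial.mem_of_prod_X_mul_mem {σ R : Type} [Fintype σ] [CommRing R] (a : Ideal R)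
    (hσ : 0 < Fintype.card σ) (q : MvPolynomial σ R)
    (hq : (∏ t, MvPolynomial.X t) * q ∈ a.map MvPolynomial.C ⊔
      Ideal.span {p | ∃ k, 1 ≤ k ∧ k < Fintype.card σ ∧ p = MvPolynomial.esymm σ R k}) :
    q ∈ a.map MvPolynomial.C ⊔
      Ideal.span {p | ∃ k, 1 ≤ k ∧ k < Fintype.card σ ∧ p = MvPolynomial.esymm σ R k} := by
  set K : Ideal (MvPolynomial σ R) := a.map MvPolynomial.C ⊔
      Ideal.span {p | ∃ k, 1 ≤ k ∧ k < Fintype.card σ ∧ p = MvPolynomial.esymm σ R k} with hK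
  set m := Fintype.card σ with hm
  obtain ⟨e⟩ : Nonempty (σ ≃ Fin m) := ⟨Fintype.equivFin σ⟩
  let p : Polynomial (Polynomial (R ⧸ a)) := Polynomial.X ^ m + Polynomial.C ((-1) ^ m * Polynomial.X)
  have hp : p.Monic := Polynomial.monic_X_pow_add_C _ hσ.ne'
  by_cases ha : Nontrivial (R ⧸ a)
  swap
  · rw [Ideal.Quotient.nontrivial_iff, not_not] at ha
    rw [hK, ha, Ideal.map_top, top_sup_eq]
    trivial
  obtain ⟨Q, _, f, y, hf, hsplit, huniv⟩ := exists_universal_splitting m _ p hp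
    (Polynomial.natDegree_X_pow_add_C)
  have hsplit' : ∏ t, (Polynomial.X - Polynomial.C (y (e t))) =
      Polynomial.X ^ m + Polynomial.C ((-1) ^ m * f Polynomial.X) := by
    rw [e.prod_comp fun j => Polynomial.X - Polynomial.C (y j), ← hsplit]
    simp [p]
  let b : R →+* Q := (f.comp Polynomial.C).comp (Ideal.Quotient.mk a)
  let φ : MvPolynomial σ R →+* Q := MvPolynomial.eval₂Hom b fun t => y (e t)
  have hφe (k : ℕ) : φ (MvPolynomial.esymm σ R k) =
      MvPolynomial.aeval (fun t => y (e t)) (MvPolynomial.esymm σ ℤ k) := by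
    simp [φ, MvPolynomial.esymm]
  have hφK : ∀ r ∈ K, φ r = 0 := by
    suffices K ≤ RingHom.ker φ from fun r hr => this hr
    refine sup_le (Ideal.map_le_iff_le_comap.mpr fun r hr => ?_) (Ideal.span_le.mpr ?_)
    · simp [φ, b, Ideal.Quotient.eq_zero_iff_mem.mpr hr]
    · rintro _ ⟨k, hk1, hk2, rfl⟩
      have h := coeff_prod_X_sub_C_eq_esymm (fun t => y (e t)) (k := k) hk2.le
      rw [hsplit', Polynomial.coeff_add, Polynomial.coeff_X_pow, Polynomial.coeff_C,
        if_neg (by omega), if_neg (by omega), add_zero] at h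
      have h' : (-1 : Q) ^ k * φ (MvPolynomial.esymm σ R k) = 0 := by rw [hφe, ← h]
      simpa using h'
  have hφv : φ (∏ t, MvPolynomial.X t) = f Polynomial.X := by
    have h := congrArg (Polynomial.eval 0) hsplit'
    simp [Polynomial.eval_prod, Finset.prod_neg, hσ.ne', ← hm] at h
    simpa [φ] using ((isUnit_one.neg.pow m).mul_right_inj).mp h
  have hφq : φ q = 0 := by
    have h := hφK _ hq
    rw [map_mul, hφv] at h
    exact (mul_left_mem_nonZeroDivisors_eq_zero_iff (hf _ Polynomial.X_mem_nonzeroDivisors)).mp h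
  let c : R ⧸ a →+* MvPolynomial σ R ⧸ K :=
    Ideal.Quotient.lift a ((Ideal.Quotient.mk K).comp MvPolynomial.C) fun r hr =>
      Ideal.Quotient.eq_zero_iff_mem.mpr (Ideal.mem_sup_left (Ideal.mem_map_of_mem _ hr))
  let v : MvPolynomial σ R ⧸ K := Ideal.Quotient.mk K (∏ t, MvPolynomial.X t)
  let z : σ → MvPolynomial σ R ⧸ K := fun t => Ideal.Quotient.mk K (MvPolynomial.X t)
  have hz : ∏ t, (Polynomial.X - Polynomial.C (z t)) =
      Polynomial.X ^ m + Polynomial.C ((-1) ^ m * ∏ t, z t) := by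
    refine prod_X_sub_C_of_esymm_eq_zero z hσ fun k hk1 hk2 => ?_
    have h : Ideal.Quotient.mk K (MvPolynomial.esymm σ R k) = 0 :=
      Ideal.Quotient.eq_zero_iff_mem.mpr (Ideal.mem_sup_right (Ideal.subset_span ⟨k, hk1, hk2, rfl⟩))
    rw [← h]
    simp [MvPolynomial.esymm, z]
  obtain ⟨g, hg, hgy⟩ := huniv _ (Polynomial.eval₂RingHom c v) (fun j => z (e.symm j)) (by
    rw [e.symm.prod_comp fun t => Polynomial.X - Polynomial.C (z t), hz]
    simp [p, v, z])
  have hgφ : g.comp φ = Ideal.Quotient.mk K := by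
    refine MvPolynomial.ringHom_ext (fun r => ?_) fun t => ?_
    · have := RingHom.congr_fun hg (Polynomial.C (Ideal.Quotient.mk a r))
      simpa [φ, b, c] using this
    · simp [φ, hgy, z]
  rw [← Ideal.Quotient.eq_zero_iff_mem, ← hgφ, RingHom.comp_apply, hφq, map_zero]

theorem MvPolynomial.IsSymmetric.mem_span_esymm {σ R : Type*} [Fintype σ] [CommRing R]
    {p : MvPolynomial σ R} (hp : p.IsSymmetric) (h0 : constantCoeff p = 0) :
    p ∈ Ideal.span {q | ∃ k, 1 ≤ k ∧ q = esymm σ R k} := by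
  set K := Ideal.span {q | ∃ k, 1 ≤ k ∧ q = esymm σ R k}
  obtain ⟨q, hq⟩ := esymmAlgHom_surjective (σ := σ) R le_rfl ⟨p, hp⟩
  have hq' : aeval (fun i : Fin (Fintype.card σ) => esymm σ R (i + 1)) q = p := by
    rw [← esymmAlgHom_apply, hq]
  have hc (k : ℕ) : constantCoeff (esymm σ R (k + 1)) = 0 := by
    rw [esymm, map_sum]
    refine Finset.sum_eq_zero fun S hS => ?_
    obtain ⟨t, ht⟩ : S.Nonempty := by
      rw [← Finset.card_pos, (Finset.mem_powersetCard.mp hS).2]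
      exact k.succ_pos
    rw [map_prod]
    exact Finset.prod_eq_zero ht (constantCoeff_X R t)
  have h1 : constantCoeff q = 0 := by
    have h : (constantCoeff (σ := σ) (R := R)).comp
        (aeval fun i : Fin (Fintype.card σ) => esymm σ R (i + 1)).toRingHom = constantCoeff := by
      refine MvPolynomial.ringHom_ext (fun r => ?_) fun i => ?_
      · simp
      · simp [hc]
    rw [← h, ← h0, ← hq']
    rfl
  have h2 : (Ideal.Quotient.mkₐ R K).comp
      (aeval fun i : Fin (Fintype.card σ) => esymm σ R (i + 1)) = aeval fun _ => 0 := by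
    refine MvPolynomial.algHom_ext fun i => ?_
    rw [AlgHom.comp_apply, aeval_X, aeval_X, Ideal.Quotient.mkₐ_eq_mk,
      Ideal.Quotient.eq_zero_iff_mem]
    exact Ideal.subset_span ⟨i + 1, by omega, rfl⟩
  rw [← Ideal.Quotient.eq_zero_iff_mem, ← Ideal.Quotient.mkₐ_eq_mk R, ← hq', ← AlgHom.comp_apply, h2]
  simp [aeval_zero', h1]

@[simp]
theorem permB_mkB (n : ℕ) (σ : Equiv.Perm (Fin n)) (p : MvPolynomial (Fin n ⊕ Fin n) ℂ) :
    permB n σ (mkB n p) = mkB n (rename (Sum.map σ σ) p) := rfl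

theorem permB_xv (n : ℕ) (σ : Equiv.Perm (Fin n)) (t : Fin n) :
    permB n σ (xv n t) = xv n (σ t) := by
  rw [xv, permB_mkB, rename_X]; rfl

theorem permB_yv (n : ℕ) (σ : Equiv.Perm (Fin n)) (t : Fin n) :
    permB n σ (yv n t) = yv n (σ t) := by
  rw [yv, permB_mkB, rename_X]; rfl

theorem permB_mul (n : ℕ) (σ τ : Equiv.Perm (Fin n)) (p : B n) :
    permB n (σ * τ) p = permB n σ (permB n τ p) := by
  obtain ⟨P, rfl⟩ := Ideal.Quotient.mkₐ_surjective ℂ (Bideal n) p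
  rw [permB_mkB, permB_mkB, permB_mkB, rename_rename, Sum.map_comp_map]
  rfl

theorem permB_one (n : ℕ) (p : B n) : permB n 1 p = p := by
  obtain ⟨P, rfl⟩ := Ideal.Quotient.mkₐ_surjective ℂ (Bideal n) p
  rw [permB_mkB]
  congr 1
  simp

theorem xv_mul_yv (n : ℕ) (t : Fin n) : xv n t * yv n t = 0 := by
  rw [xv, yv, ← map_mul]
  exact Ideal.Quotient.eq_zero_iff_mem.mpr (Ideal.subset_span ⟨t, rfl⟩)

theorem sum_permB_aeval_monomial_mem {n : ℕ} {v : Fin n → B n}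
    (hv : ∀ σ t, permB n σ (v t) = v (σ t)) {K : Ideal (B n)}
    (hK : ∀ k, 1 ≤ k → ∑ S ∈ Finset.powersetCard k Finset.univ, ∏ t ∈ S, v t ∈ K)
    {α : Fin n →₀ ℕ} (hα : α ≠ 0) :
    ∑ σ, permB n σ (aeval v (monomial α (1 : ℂ))) ∈ K := by
  have hcomp (σ : Equiv.Perm (Fin n)) (p : MvPolynomial (Fin n) ℂ) :
      permB n σ (aeval v p) = aeval v (rename σ p) := by
    rw [aeval_rename, ← AlgHom.comp_apply]
    congr 1
    refine MvPolynomial.algHom_ext fun t => ?_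
    simp [hv]
  simp_rw [hcomp, ← map_sum]
  have hsymm : (∑ σ : Equiv.Perm (Fin n), rename σ (monomial α (1 : ℂ))).IsSymmetric := by
    intro e
    rw [map_sum]
    refine Eq.trans ?_ (Equiv.sum_comp (Equiv.mulLeft e) _)
    exact Finset.sum_congr rfl fun σ _ => by rw [rename_rename]; rfl
  have h := hsymm.mem_span_esymm (by
    simp [constantCoeff_monomial, hα])
  suffices Ideal.span _ ≤ K.comap (aeval v) from this h
  rw [Ideal.span_le]
  rintro _ ⟨k, hk, rfl⟩
  simpa [esymm] using hK k hk

theorem mul_permB_eq_zero {n : ℕ} {α β : Fin n →₀ ℕ} {ρ : Equiv.Perm (Fin n)} {u : Fin n}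
    (hα : ρ u ∈ α.support) (hβ : u ∈ β.support) :
    aeval (xv n) (monomial α (1 : ℂ)) * permB n ρ (aeval (yv n) (monomial β (1 : ℂ))) = 0 := by
  have h1 : xv n (ρ u) ∣ aeval (xv n) (monomial α (1 : ℂ)) := by
    rw [aeval_monomial, map_one, one_mul]
    exact (dvd_pow_self _ (Finsupp.mem_support_iff.mp hα)).trans (Finset.dvd_prod_of_mem _ hα)
  have h2 : yv n (ρ u) ∣ permB n ρ (aeval (yv n) (monomial β (1 : ℂ))) := by
    rw [aeval_monomial, map_one, one_mul, ← permB_yv]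
    exact map_dvd _
      ((dvd_pow_self _ (Finsupp.mem_support_iff.mp hβ)).trans (Finset.dvd_prod_of_mem _ hβ))
  exact zero_dvd_iff.mp (xv_mul_yv n (ρ u) ▸ mul_dvd_mul h1 h2)

theorem permB_aeval_monomial_congr {n : ℕ} {v : Fin n → B n}
    (hv : ∀ σ t, permB n σ (v t) = v (σ t)) {α : Fin n →₀ ℕ} {κ ρ : Equiv.Perm (Fin n)}
    (h : ∀ t ∈ α.support, κ t = ρ t) :
    permB n κ (aeval v (monomial α (1 : ℂ))) = permB n ρ (aeval v (monomial α (1 : ℂ))) := by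
  rw [aeval_monomial, map_one, one_mul, Finsupp.prod, map_prod, map_prod]
  exact Finset.prod_congr rfl fun t ht => by rw [map_pow, map_pow, hv, hv, h t ht]

theorem exists_permB_eq_mul_permB {n : ℕ} {α β : Fin n →₀ ℕ} (hαβ : Disjoint α.support β.support)
    {ρ : Equiv.Perm (Fin n)} (hρ : ∀ u ∈ β.support, ρ u ∉ α.support) :
    ∃ κ, aeval (xv n) (monomial α (1 : ℂ)) * permB n ρ (aeval (yv n) (monomial β (1 : ℂ))) =
      permB n κ (aeval (xv n) (monomial α (1 : ℂ)) * aeval (yv n) (monomial β (1 : ℂ))) := by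
  let f : Fin n → Fin n := fun t => if t ∈ α.support then t else ρ t
  obtain ⟨g, hg⟩ := Set.MapsTo.exists_equiv_extend_of_card_eq (t := (Finset.univ : Finset (Fin n)))
    (s := (↑(α.support ∪ β.support) : Set (Fin n))) (f := f) (by simp) (fun _ _ => by simp) (by
      intro a ha b hb hab
      simp only [Finset.coe_union, Set.mem_union, Finset.mem_coe] at ha hb
      simp only [f] at hab
      split_ifs at hab with h1 h2 h2
      · exact hab
      · exact absurd (hab ▸ h1) (hρ b (hb.resolve_left h2))
      · exact absurd (hab ▸ h2) (hρ a (ha.resolve_left h1))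
      · exact ρ.injective hab)
  let κ : Equiv.Perm (Fin n) := g.trans (Equiv.subtypeUnivEquiv fun t => Finset.mem_univ t)
  have hκ (t : Fin n) (ht : t ∈ α.support ∪ β.support) : κ t = f t := hg t ht
  refine ⟨κ, ?_⟩
  rw [map_mul, permB_aeval_monomial_congr (permB_yv n) (κ := κ) (ρ := ρ) fun t ht => ?_,
    permB_aeval_monomial_congr (permB_xv n) (κ := κ) (ρ := 1) fun t ht => ?_, permB_one]
  · rw [hκ t (Finset.mem_union_left _ ht)]
    exact if_pos ht
  · rw [hκ t (Finset.mem_union_right _ ht)]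
    exact if_neg (Finset.disjoint_right.mp hαβ ht)

theorem sum_permB_mul_mem {n : ℕ} {K : Ideal (B n)} (hX : ∀ k, 1 ≤ k → eX n k ∈ K)
    (hY : ∀ k, 1 ≤ k → fY n k ∈ K) {α β : Fin n →₀ ℕ} (h0 : α ≠ 0 ∨ β ≠ 0) :
    ∑ σ, permB n σ (aeval (xv n) (monomial α (1 : ℂ)) * aeval (yv n) (monomial β (1 : ℂ))) ∈ K := by
  classical
  by_cases hαβ : Disjoint α.support β.support
  swap
  · obtain ⟨t, h1, h2⟩ := Finset.not_disjoint_iff.mp hαβ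
    have h := mul_permB_eq_zero (ρ := 1) h1 h2
    rw [permB_one] at h
    simp [h]
  set a := aeval (xv n) (monomial α (1 : ℂ))
  set b := aeval (yv n) (monomial β (1 : ℂ))
  have hmem : (∑ σ, permB n σ a) * ∑ σ, permB n σ b ∈ K := by
    rcases h0 with h | h
    · exact K.mul_mem_right _ (sum_permB_aeval_monomial_mem (permB_xv n) hX h)
    · exact K.mul_mem_left _ (sum_permB_aeval_monomial_mem (permB_yv n) hY h)
  let G : Finset (Equiv.Perm (Fin n)) :=
    Finset.univ.filter fun ρ => ∀ u ∈ β.support, ρ u ∉ α.support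
  have hprod : (∑ σ, permB n σ a) * ∑ σ, permB n σ b = (G.card : ℂ) • ∑ σ, permB n σ (a * b) := by
    have h1 : (∑ σ, permB n σ a) * ∑ σ, permB n σ b =
        ∑ ρ, ∑ σ, permB n σ (a * permB n ρ b) := by
      rw [Finset.sum_mul, Finset.sum_comm]
      refine Finset.sum_congr rfl fun σ _ => ?_
      rw [Finset.mul_sum, ← Equiv.sum_comp (Equiv.mulLeft σ)]
      exact Finset.sum_congr rfl fun ρ _ => by rw [map_mul, Equiv.coe_mulLeft, permB_mul]
    rw [h1, Nat.cast_smul_eq_nsmul, ← Finset.sum_const, Finset.sum_filter]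
    refine Finset.sum_congr rfl fun ρ _ => ?_
    split_ifs with hρ
    · obtain ⟨κ, hκ⟩ := exists_permB_eq_mul_permB hαβ hρ
      rw [hκ]
      refine Eq.trans ?_ (Equiv.sum_comp (Equiv.mulRight κ) _)
      exact Finset.sum_congr rfl fun σ _ => by rw [Equiv.coe_mulRight, permB_mul]
    · push Not at hρ
      obtain ⟨u, hu1, hu2⟩ := hρ
      simp [a, b, mul_permB_eq_zero hu2 hu1]
  have hG : (G.card : ℂ) ≠ 0 := by
    rw [Nat.cast_ne_zero, ← Nat.pos_iff_ne_zero, Finset.card_pos]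
    exact ⟨1, Finset.mem_filter.mpr ⟨Finset.mem_univ _, fun u hu => Finset.disjoint_right.mp hαβ hu⟩⟩
  rw [hprod] at hmem
  have h := Submodule.smul_of_tower_mem K (G.card : ℂ)⁻¹ hmem
  rwa [inv_smul_smul₀ hG] at h

theorem Jn_le {n : ℕ} {K : Ideal (B n)} (hX : ∀ k, 1 ≤ k → eX n k ∈ K)
    (hY : ∀ k, 1 ≤ k → fY n k ∈ K) : Jn n ≤ K := by
  rw [Jn, Ideal.span_le]
  rintro p ⟨hp, hp0⟩
  obtain ⟨P, rfl⟩ := Ideal.Quotient.mkₐ_surjective ℂ (Bideal n) p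
  have hP0 : constantCoeff P = 0 := by
    have h : ev0 n (mkB n P) = aeval (fun _ => (0 : ℂ)) P := rfl
    rw [hp0, aeval_zero'] at h
    simpa using h.symm
  have hsum : ∑ σ, permB n σ (mkB n P) = (Nat.factorial n : ℂ) • mkB n P := by
    rw [Finset.sum_congr rfl fun σ _ => hp σ, Finset.sum_const, Finset.card_univ,
      Fintype.card_perm, Fintype.card_fin, Nat.cast_smul_eq_nsmul]
  have hmono (m : Fin n ⊕ Fin n →₀ ℕ) (hm : m ≠ 0) :
      ∑ σ, permB n σ (mkB n (monomial m 1)) ∈ K := by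
    set α : Fin n →₀ ℕ := (Finsupp.sumFinsuppEquivProdFinsupp m).1
    set β : Fin n →₀ ℕ := (Finsupp.sumFinsuppEquivProdFinsupp m).2
    have h : mkB n (monomial m 1) =
        aeval (xv n) (monomial α (1 : ℂ)) * aeval (yv n) (monomial β (1 : ℂ)) := by
      rw [monomial_eq, map_mul, Finsupp.prod_fintype _ _ (by simp), Fintype.prod_sum_type, aeval_monomial,
        aeval_monomial, Finsupp.prod_fintype _ _ (by simp), Finsupp.prod_fintype _ _ (by simp)]
      simp [α, β, xv, yv]
    rw [h]
    refine sum_permB_mul_mem hX hY ?_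
    by_contra! h'
    exact hm (Finsupp.sumFinsuppEquivProdFinsupp.injective
      (Prod.ext (by simpa [α] using h'.1) (by simpa [β] using h'.2)))
  have hmem : ∑ σ, permB n σ (mkB n P) ∈ K := by
    rw [P.as_sum]
    simp_rw [map_sum]
    rw [Finset.sum_comm]
    refine K.sum_mem fun m hm => ?_
    have h : monomial m (coeff m P) = coeff m P • monomial m (1 : ℂ) := by simp [smul_monomial]
    simp_rw [h, map_smul, ← Finset.smul_sum]
    refine Submodule.smul_of_tower_mem K _ (hmono m ?_)
    rintro rfl
    exact (mem_support_iff.mp hm) hP0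
  rw [hsum] at hmem
  have h := Submodule.smul_of_tower_mem K (Nat.factorial n : ℂ)⁻¹ hmem
  rwa [inv_smul_smul₀ (by exact_mod_cast n.factorial_ne_zero)] at h

theorem prod_mem_of_card_le {n m : ℕ} {v : Fin n → B n} {K : Ideal (B n)}
    (hK : ∀ S : Finset (Fin n), S.card = m → ∏ t ∈ S, v t ∈ K) {S : Finset (Fin n)}
    (hS : m ≤ S.card) : ∏ t ∈ S, v t ∈ K := by
  obtain ⟨S', hS', hc⟩ := Finset.exists_subset_card_eq hS
  exact K.mem_of_dvd (Finset.prod_dvd_prod_of_subset _ _ _ hS') (hK S' hc)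

theorem sum_prod_mem_of_le {n m k : ℕ} {v : Fin n → B n} {K : Ideal (B n)}
    (hK : ∀ S : Finset (Fin n), S.card = m → ∏ t ∈ S, v t ∈ K) (hk : m ≤ k) :
    ∑ S ∈ Finset.powersetCard k Finset.univ, ∏ t ∈ S, v t ∈ K :=
  K.sum_mem fun _ hS => prod_mem_of_card_le hK (hk.trans_eq (Finset.mem_powersetCard.mp hS).2.symm)

theorem prod_yv_mem_FB {n m : ℕ} {S : Finset (Fin n)} (hS : m ≤ S.card) :
    ∏ t ∈ S, yv n t ∈ FB n m :=
  prod_mem_of_card_le (K := FB n m) (fun S' h => Ideal.subset_span ⟨S', h, rfl⟩) hS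

theorem fY_mem_FB (n k : ℕ) : fY n k ∈ FB n k :=
  sum_prod_mem_of_le (fun _ h => prod_yv_mem_FB h.ge) le_rfl

theorem FB_succ_le (n m : ℕ) : FB n (m + 1) ≤ FB n m := by
  rw [FB, Ideal.span_le]
  rintro _ ⟨J, hJ, rfl⟩
  exact prod_yv_mem_FB (by omega)

theorem prod_xv_mem_Iij (n i j : ℕ) {S : Finset (Fin n)} (hS : S.card = i) :
    ∏ t ∈ S, xv n t ∈ Iij n i j :=
  Ideal.subset_span (Or.inl (Or.inl (Or.inr ⟨S, hS, rfl⟩)))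

theorem prod_yv_mem_Iij (n i j : ℕ) {S : Finset (Fin n)} (hS : S.card = j) :
    ∏ t ∈ S, yv n t ∈ Iij n i j :=
  Ideal.subset_span (Or.inr ⟨S, hS, rfl⟩)

theorem eX_mem_Iij (n i j : ℕ) {k : ℕ} (hk : 1 ≤ k) : eX n k ∈ Iij n i j := by
  rcases lt_or_ge k i with h | h
  · exact Ideal.subset_span (Or.inl (Or.inl (Or.inl ⟨k, hk, h, rfl⟩)))
  · exact sum_prod_mem_of_le (fun _ hS => prod_xv_mem_Iij n i j hS) h

theorem fY_mem_Iij (n i j : ℕ) {k : ℕ} (hk : 1 ≤ k) : fY n k ∈ Iij n i j := by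
  rcases lt_or_ge k j with h | h
  · exact Ideal.subset_span (Or.inl (Or.inr ⟨k, hk, h, rfl⟩))
  · exact sum_prod_mem_of_le (fun _ hS => prod_yv_mem_Iij n i j hS) h

theorem Jn_le_Iij (n i j : ℕ) : Jn n ≤ Iij n i j :=
  Jn_le (fun _ hk => eX_mem_Iij n i j hk) fun _ hk => fY_mem_Iij n i j hk

theorem FB_le_Iij (n i j : ℕ) : FB n j ≤ Iij n i j := by
  rw [FB, Ideal.span_le]
  rintro _ ⟨J, hJ, rfl⟩
  exact prod_yv_mem_Iij n i j hJ

theorem Iij_succ_le (n i j : ℕ) : Iij n i (j + 1) ≤ Iij n i j := by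
  rw [Iij, Ideal.span_le]
  rintro _ (((⟨k, hk, -, rfl⟩ | ⟨I, hI, rfl⟩) | ⟨k, hk, -, rfl⟩) | ⟨J, hJ, rfl⟩)
  · exact eX_mem_Iij n i j hk
  · exact prod_xv_mem_Iij n i j hI
  · exact fY_mem_Iij n i j hk
  · exact FB_le_Iij n i j (prod_yv_mem_FB (by omega))

theorem Iij_le_sup_FB (n i j : ℕ) : Iij n i j ≤ Iij n i (j + 1) ⊔ FB n j := by
  rw [Iij, Ideal.span_le]
  rintro _ (((⟨k, hk, -, rfl⟩ | ⟨I, hI, rfl⟩) | ⟨k, hk, -, rfl⟩) | ⟨J, hJ, rfl⟩)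
  · exact Ideal.mem_sup_left (eX_mem_Iij n i _ hk)
  · exact Ideal.mem_sup_left (prod_xv_mem_Iij n i _ hI)
  · exact Ideal.mem_sup_left (fY_mem_Iij n i _ hk)
  · exact Ideal.mem_sup_right (prod_yv_mem_FB hJ.ge)

theorem sum_prod_mem_Jn {n k : ℕ} (hk : 1 ≤ k) {v : Fin n → B n}
    (hv : ∀ σ t, permB n σ (v t) = v (σ t)) (h0 : ∀ t, ev0 n (v t) = 0) :
    ∑ S ∈ Finset.powersetCard k Finset.univ, ∏ t ∈ S, v t ∈ Jn n := by
  have h (σ : Equiv.Perm (Fin n)) (p : MvPolynomial (Fin n) ℂ) :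
      permB n σ (aeval v p) = aeval v (rename σ p) := by
    rw [aeval_rename, ← AlgHom.comp_apply]
    congr 1
    refine MvPolynomial.algHom_ext fun t => ?_
    simp [hv]
  refine Ideal.subset_span ⟨fun σ => ?_, ?_⟩
  · have h1 : ∑ S ∈ Finset.powersetCard k Finset.univ, ∏ t ∈ S, v t =
        aeval v (esymm (Fin n) ℂ k) := by simp [esymm]
    rw [h1, h, rename_esymm]
  · rw [map_sum]
    refine Finset.sum_eq_zero fun S hS => ?_
    obtain ⟨t, ht⟩ : S.Nonempty := by
      rw [← Finset.card_pos, (Finset.mem_powersetCard.mp hS).2]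
      exact hk
    rw [map_prod]
    exact Finset.prod_eq_zero ht (h0 t)

theorem ev0_xv (n : ℕ) (t : Fin n) : ev0 n (xv n t) = 0 :=
  aeval_X (R := ℂ) (fun _ => (0 : ℂ)) (Sum.inl t)

theorem ev0_yv (n : ℕ) (t : Fin n) : ev0 n (yv n t) = 0 :=
  aeval_X (R := ℂ) (fun _ => (0 : ℂ)) (Sum.inr t)

theorem eX_mem_Jn (n : ℕ) {k : ℕ} (hk : 1 ≤ k) : eX n k ∈ Jn n :=
  sum_prod_mem_Jn hk (permB_xv n) (ev0_xv n)

theorem fY_mem_Jn (n : ℕ) {k : ℕ} (hk : 1 ≤ k) : fY n k ∈ Jn n :=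
  sum_prod_mem_Jn hk (permB_yv n) (ev0_yv n)

/-- The polynomial ring in the `y_t` for `t ∈ T` over the polynomial ring in the `x_t`. -/
abbrev FacetRing {n : ℕ} (T : Finset (Fin n)) : Type := MvPolynomial T (MvPolynomial (Fin n) ℂ)

/-- The restriction of `B n` to the facet where the `y_t` with `t ∈ T` and the `x_t` with `t ∉ T`
survive. -/
def toFacet {n : ℕ} (T : Finset (Fin n)) : B n →ₐ[ℂ] FacetRing T :=
  Ideal.Quotient.liftₐ (Bideal n)
    (aeval (Sum.elim (fun t => if t ∈ T then 0 else C (X t))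
      fun t => if h : t ∈ T then X ⟨t, h⟩ else 0))
    (by
      suffices Bideal n ≤ RingHom.ker (aeval (R := ℂ) (S₁ := FacetRing T)
          (Sum.elim (fun t => if t ∈ T then 0 else C (X t))
            fun t => if h : t ∈ T then X ⟨t, h⟩ else 0)) from fun a ha => this ha
      rw [Ideal.span_le]
      rintro _ ⟨t, rfl⟩
      by_cases h : t ∈ T <;> simp [RingHom.mem_ker, h])

theorem toFacet_xv {n : ℕ} (T : Finset (Fin n)) (t : Fin n) :
    toFacet T (xv n t) = C (if t ∈ T then 0 else X t) := by
  refine (aeval_X (R := ℂ) _ (Sum.inl t)).trans ?_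
  rw [Sum.elim_inl]
  split_ifs <;> simp

theorem toFacet_yv {n : ℕ} (T : Finset (Fin n)) (t : Fin n) :
    toFacet T (yv n t) = if h : t ∈ T then X ⟨t, h⟩ else 0 :=
  aeval_X (R := ℂ) _ (Sum.inr t)

/-- The ring homomorphism sending the variables of the facet ring to those of `B n`. -/
def ofFacet {n : ℕ} (T : Finset (Fin n)) : FacetRing T →+* B n :=
  eval₂Hom (aeval (R := ℂ) (xv n)).toRingHom fun t => yv n t

theorem prod_yv_mul_ofFacet_toFacet_sub_mem {n : ℕ} (T : Finset (Fin n)) (b : B n) :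
    (∏ t ∈ T, yv n t) * (ofFacet T (toFacet T b) - b) ∈ FB n (T.card + 1) := by
  let N : Ideal (B n) := Submodule.comap (LinearMap.mulLeft (B n) (∏ t ∈ T, yv n t))
    (FB n (T.card + 1))
  have hmemN (c : B n) : c ∈ N ↔ (∏ t ∈ T, yv n t) * c ∈ FB n (T.card + 1) := Iff.rfl
  rw [← hmemN]
  obtain ⟨P, rfl⟩ := Ideal.Quotient.mkₐ_surjective ℂ (Bideal n) b
  rw [← Ideal.Quotient.eq]
  suffices ((Ideal.Quotient.mk N).comp (ofFacet T)).comp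
      ((toFacet T).toRingHom.comp (mkB n).toRingHom) =
      (Ideal.Quotient.mk N).comp (mkB n).toRingHom from RingHom.congr_fun this P
  refine MvPolynomial.ringHom_ext (fun r => ?_) ?_
  · change Ideal.Quotient.mk N (ofFacet T (toFacet T (mkB n (algebraMap ℂ _ r)))) =
      Ideal.Quotient.mk N (mkB n (algebraMap ℂ _ r))
    rw [AlgHom.commutes, AlgHom.commutes]
    rw [IsScalarTower.algebraMap_apply ℂ (MvPolynomial (Fin n) ℂ) (FacetRing T),
      MvPolynomial.algebraMap_eq, ofFacet, coe_eval₂Hom, eval₂_C]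
    exact congrArg _ (AlgHom.commutes (aeval (xv n)) r)
  · rintro (t | t)
    · change Ideal.Quotient.mk N (ofFacet T (toFacet T (xv n t))) = Ideal.Quotient.mk N (xv n t)
      rw [toFacet_xv]
      split_ifs with h
      · rw [map_zero, map_zero, map_zero, eq_comm, Ideal.Quotient.eq_zero_iff_mem, hmemN]
        have : (∏ t ∈ T, yv n t) * xv n t = 0 := by
          rw [← Finset.mul_prod_erase T _ h, mul_right_comm, mul_comm (yv n t), xv_mul_yv, zero_mul]
        rw [this]
        exact zero_mem _
      · simp [ofFacet]
    · change Ideal.Quotient.mk N (ofFacet T (toFacet T (yv n t))) = Ideal.Quotient.mk N (yv n t)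
      rw [toFacet_yv]
      split_ifs with h
      · simp [ofFacet]
      · rw [map_zero, map_zero, eq_comm, Ideal.Quotient.eq_zero_iff_mem, hmemN, mul_comm,
          ← Finset.prod_insert h]
        exact prod_yv_mem_FB (Finset.card_insert_of_notMem h).ge

theorem toFacet_eX {n : ℕ} (T : Finset (Fin n)) (k : ℕ) :
    toFacet T (eX n k) =
      C (∑ S ∈ Finset.powersetCard k Finset.univ, ∏ t ∈ S, if t ∈ T then 0 else X t) := by
  simp_rw [eX, map_sum, map_prod, toFacet_xv]

theorem toFacet_prod_yv {n : ℕ} (T : Finset (Fin n)) :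
    toFacet T (∏ t ∈ T, yv n t) = ∏ t : T, X t := by
  rw [map_prod, ← Finset.prod_coe_sort]
  exact Finset.prod_congr rfl fun t _ => by rw [toFacet_yv, dif_pos t.2]

theorem toFacet_prod_yv_eq_zero {n : ℕ} {T J : Finset (Fin n)} (h : ¬ J ⊆ T) :
    toFacet T (∏ t ∈ J, yv n t) = 0 := by
  obtain ⟨t, htJ, htT⟩ := Finset.not_subset.mp h
  rw [map_prod]
  exact Finset.prod_eq_zero htJ (by rw [toFacet_yv, dif_neg htT])

theorem toFacet_prod_xv_eq_zero {n : ℕ} {T I : Finset (Fin n)} (h : ¬ Disjoint I T) :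
    toFacet T (∏ t ∈ I, xv n t) = 0 := by
  obtain ⟨t, htI, htT⟩ := Finset.not_disjoint_iff.mp h
  rw [map_prod]
  exact Finset.prod_eq_zero htI (by rw [toFacet_xv, if_pos htT, map_zero])

theorem toFacet_fY {n : ℕ} (T : Finset (Fin n)) (k : ℕ) :
    toFacet T (fY n k) = esymm T (MvPolynomial (Fin n) ℂ) k := by
  have h1 : Finset.powersetCard k T ⊆ Finset.powersetCard k Finset.univ :=
    Finset.powersetCard_mono (Finset.subset_univ T)
  rw [fY, map_sum, ← Finset.sum_subset h1 fun S hS hS' => toFacet_prod_yv_eq_zero fun h =>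
    hS' (Finset.mem_powersetCard.mpr ⟨h, (Finset.mem_powersetCard.mp hS).2⟩)]
  have h2 : Finset.univ.map (Function.Embedding.subtype (· ∈ T)) = T := by
    ext t
    simp
  have h3 := Finset.powersetCard_map (Function.Embedding.subtype (· ∈ T)) k Finset.univ
  rw [h2] at h3
  rw [h3, Finset.sum_map, esymm]
  refine Finset.sum_congr rfl fun S _ => ?_
  simp [Finset.mapEmbedding_apply, Finset.prod_map, toFacet_yv]

/-- The ideal generated by the `e_k`, by `f_1, …, f_{i-1}` and by the `x_I` with `|I| = n - i`. -/
def facetIdeal (n i : ℕ) : Ideal (B n) :=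
  Ideal.span ({p | ∃ k, 1 ≤ k ∧ p = eX n k} ∪ {p | ∃ k, 1 ≤ k ∧ k < i ∧ p = fY n k} ∪
    {p | ∃ I : Finset (Fin n), I.card = n - i ∧ p = ∏ t ∈ I, xv n t})

theorem toFacet_prod_xv_compl {n : ℕ} (T : Finset (Fin n)) :
    toFacet T (∏ t ∈ Tᶜ, xv n t) = toFacet T (eX n (n - T.card)) := by
  rw [eX, map_sum, Finset.sum_eq_single Tᶜ]
  · intro S hS hST
    refine toFacet_prod_xv_eq_zero fun h => hST ?_
    refine Finset.eq_of_subset_of_card_le (Finset.subset_compl_iff_disjoint_right.mpr h) ?_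
    rw [(Finset.mem_powersetCard.mp hS).2, Finset.card_compl, Fintype.card_fin]
  · intro h
    simp [Finset.card_compl] at h

/-- The ideal of the facet ring generated by the images of the `e_k` and `f_1, …, f_{|T|-1}`. -/
def esymmIdeal {n : ℕ} (T : Finset (Fin n)) : Ideal (FacetRing T) :=
  (Ideal.span {r : MvPolynomial (Fin n) ℂ | ∃ k, 1 ≤ k ∧
      r = ∑ S ∈ Finset.powersetCard k Finset.univ, ∏ t ∈ S, if t ∈ T then 0 else X t}).map C ⊔
    Ideal.span {p | ∃ k, 1 ≤ k ∧ k < Fintype.card T ∧ p = esymm T (MvPolynomial (Fin n) ℂ) k}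

theorem toFacet_eX_mem {n : ℕ} (T : Finset (Fin n)) {k : ℕ} (hk : 1 ≤ k) :
    toFacet T (eX n k) ∈ esymmIdeal T := by
  rw [toFacet_eX]
  exact Ideal.mem_sup_left (Ideal.mem_map_of_mem _ (Ideal.subset_span ⟨k, hk, rfl⟩))

theorem facetIdeal_le {n i : ℕ} (hi : i < n) {T : Finset (Fin n)} (hT : T.card = i) :
    facetIdeal n i ≤ (esymmIdeal T).comap (toFacet T) := by
  rw [facetIdeal, Ideal.span_le]
  rintro _ ((⟨k, hk, rfl⟩ | ⟨k, hk, hki, rfl⟩) | ⟨I, hI, rfl⟩)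
  · exact toFacet_eX_mem T hk
  · change toFacet T (fY n k) ∈ esymmIdeal T
    rw [toFacet_fY]
    exact Ideal.mem_sup_right (Ideal.subset_span ⟨k, hk, by simpa [hT] using hki, rfl⟩)
  · change toFacet T (∏ t ∈ I, xv n t) ∈ esymmIdeal T
    by_cases h : Disjoint I T
    · have hIT : I = Tᶜ := Finset.eq_of_subset_of_card_le
        (Finset.subset_compl_iff_disjoint_right.mpr h) (by
          rw [hI, Finset.card_compl, Fintype.card_fin, hT])
      rw [hIT, toFacet_prod_xv_compl]
      exact toFacet_eX_mem T (by omega)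
    · rw [toFacet_prod_xv_eq_zero h]
      exact zero_mem _

theorem prod_yv_mul_ofFacet_mem {n : ℕ} (T : Finset (Fin n)) {c : FacetRing T}
    (hc : c ∈ esymmIdeal T) :
    (∏ t ∈ T, yv n t) * ofFacet T c ∈ Jn n ⊓ FB n T.card ⊔ FB n (T.card + 1) := by
  set W := Jn n ⊓ FB n T.card ⊔ FB n (T.card + 1)
  have key (b : B n) (hb : b ∈ Jn n) : (∏ t ∈ T, yv n t) * ofFacet T (toFacet T b) ∈ W := by
    have h1 : (∏ t ∈ T, yv n t) * b ∈ W := Ideal.mem_sup_left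
      ⟨Ideal.mul_mem_left _ _ hb, Ideal.mul_mem_right _ _ (prod_yv_mem_FB le_rfl)⟩
    have h2 : _ ∈ W := Ideal.mem_sup_right (prod_yv_mul_ofFacet_toFacet_sub_mem T b)
    rw [mul_sub] at h2
    exact (Submodule.sub_mem_iff_left _ h1).mp h2
  let N : Ideal (B n) := Submodule.comap (LinearMap.mulLeft (B n) (∏ t ∈ T, yv n t)) W
  suffices esymmIdeal T ≤ N.comap (ofFacet T) from this hc
  refine sup_le (Ideal.map_le_iff_le_comap.mpr (Ideal.span_le.mpr ?_)) (Ideal.span_le.mpr ?_)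
  · rintro _ ⟨k, hk, rfl⟩
    change _ * ofFacet T (C _) ∈ W
    rw [← toFacet_eX]
    exact key _ (eX_mem_Jn n hk)
  · rintro _ ⟨k, hk, -, rfl⟩
    change _ * ofFacet T _ ∈ W
    rw [← toFacet_fY]
    exact key _ (fY_mem_Jn n hk)

theorem facetIdeal_inf_FB_le {n i : ℕ} (hi0 : 1 ≤ i) (hi : i < n) :
    facetIdeal n i ⊓ FB n i ≤ Jn n ⊓ FB n i ⊔ FB n (i + 1) := by
  rintro p ⟨hpL, hpF⟩
  have hFB : FB n i = Ideal.span ((fun J => ∏ t ∈ J, yv n t) ''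
      (Finset.powersetCard i (Finset.univ : Finset (Fin n)) : Set (Finset (Fin n)))) := by
    rw [FB]
    congr 1
    ext b
    simp [eq_comm]
  rw [SetLike.mem_coe, hFB, Ideal.span, Submodule.mem_span_image_finset_iff_exists_fun'] at hpF
  obtain ⟨b, rfl⟩ := hpF
  refine Ideal.sum_mem _ fun T hT => ?_
  obtain rfl : T.card = i := (Finset.mem_powersetCard.mp hT).2
  have h1 := facetIdeal_le hi rfl hpL
  rw [Ideal.mem_comap, map_sum, Finset.sum_eq_single T, smul_eq_mul, map_mul, toFacet_prod_yv,
    mul_comm] at h1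
  · have h2 := mem_of_prod_X_mul_mem _ (by simpa using hi0) _ h1
    have h3 := prod_yv_mul_ofFacet_mem T h2
    have h4 := Ideal.mem_sup_right (S := Jn n ⊓ FB n T.card)
      (prod_yv_mul_ofFacet_toFacet_sub_mem T (b T))
    rw [mul_sub] at h4
    rw [smul_eq_mul, mul_comm]
    exact (Submodule.sub_mem_iff_right _ h3).mp h4
  · intro J hJ hJT
    rw [smul_eq_mul, map_mul, toFacet_prod_yv_eq_zero, mul_zero]
    exact fun h => hJT (Finset.eq_of_subset_of_card_le h (Finset.mem_powersetCard.mp hJ).2.ge)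
  · exact fun h => absurd hT h

theorem FB_inf_Iij_le {n i : ℕ} (hi0 : 1 ≤ i) (hi : i < n) :
    FB n i ⊓ Iij n (n - i) (i + 1) ≤ Jn n ⊓ FB n i ⊔ FB n (i + 1) := by
  have hle : Iij n (n - i) (i + 1) ≤ facetIdeal n i ⊔ (Ideal.span {fY n i} ⊔ FB n (i + 1)) := by
    rw [Iij, Ideal.span_le]
    rintro _ (((⟨k, hk, -, rfl⟩ | ⟨I, hI, rfl⟩) | ⟨k, hk, hki, rfl⟩) | ⟨J, hJ, rfl⟩)
    · exact Ideal.mem_sup_left (Ideal.subset_span (Or.inl (Or.inl ⟨k, hk, rfl⟩)))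
    · exact Ideal.mem_sup_left (Ideal.subset_span (Or.inr ⟨I, hI, rfl⟩))
    · rcases (Nat.lt_succ_iff.mp hki).lt_or_eq with h | rfl
      · exact Ideal.mem_sup_left (Ideal.subset_span (Or.inl (Or.inr ⟨k, hk, h, rfl⟩)))
      · exact Ideal.mem_sup_right (Ideal.mem_sup_left (Ideal.mem_span_singleton_self _))
    · exact Ideal.mem_sup_right (Ideal.mem_sup_right (prod_yv_mem_FB hJ.ge))
  have hr : Ideal.span {fY n i} ⊔ FB n (i + 1) ≤ Jn n ⊓ FB n i ⊔ FB n (i + 1) := by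
    refine sup_le_sup_right ((Ideal.span_singleton_le_iff_mem _).mpr ?_) _
    exact ⟨fY_mem_Jn n hi0, fY_mem_FB n i⟩
  rintro p ⟨hpF, hpI⟩
  obtain ⟨l, hl, r, hr', rfl⟩ := Submodule.mem_sup.mp (hle hpI)
  have hrF : r ∈ FB n i := (hr.trans (sup_le inf_le_right (FB_succ_le n i))) hr'
  have hlF : l ∈ FB n i := (Submodule.add_mem_iff_left _ hrF).mp hpF
  exact add_mem (facetIdeal_inf_FB_le hi0 hi ⟨hl, hlF⟩) (hr hr')

/-- For `n ≥ 2` and `1 ≤ i ≤ n−1`, there is a short exact sequence of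
`ℂ[Sₙ]`-modules `0 → Rₙ^{(i)} →^φ R^n_{n−i,i+1} →^ψ R^n_{n−i,i} → 0`, where
`Rₙ^{(i)} = F^i Bₙ / (F^i Jₙ + F^{i+1} Bₙ)`, `φ` is induced by the inclusion
`F^i Jₙ + F^{i+1} Bₙ ⊆ I^n_{n−i,i+1}` and `ψ` is the natural quotient map coming from
the inclusion of ideals `I^n_{n−i,i+1} ⊆ I^n_{n−i,i}` (both maps are characterized on
representatives, hence automatically `Sₙ`-equivariant). -/
theorem graded_piece_short_exact_sequence (n i : ℕ) (hn : 2 ≤ n) (hi1 : 1 ≤ i)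
    (hi2 : i ≤ n - 1) :
    ∃ (φ : SQ n (FB n i) (Jn n ⊓ FB n i ⊔ FB n (i + 1)) →ₗ[ℂ] (B n ⧸ Iij n (n - i) (i + 1)))
      (ψ : (B n ⧸ Iij n (n - i) (i + 1)) →ₗ[ℂ] (B n ⧸ Iij n (n - i) i)),
      (∀ (p : B n) (hp : p ∈ FB n i),
        φ (sqMk n (FB n i) (Jn n ⊓ FB n i ⊔ FB n (i + 1)) p hp) =
          Ideal.Quotient.mk (Iij n (n - i) (i + 1)) p) ∧
      (∀ P : B n, ψ (Ideal.Quotient.mk (Iij n (n - i) (i + 1)) P) =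
          Ideal.Quotient.mk (Iij n (n - i) i) P) ∧
      Function.Injective φ ∧
      Function.Surjective ψ ∧
      LinearMap.range φ = LinearMap.ker ψ := by
  have hin : i < n := by omega
  have hφ : Submodule.comap ((FB n i).restrictScalars ℂ).subtype
        ((Jn n ⊓ FB n i ⊔ FB n (i + 1)).restrictScalars ℂ) ≤
      LinearMap.ker ((Ideal.Quotient.mkₐ ℂ (Iij n (n - i) (i + 1))).toLinearMap ∘ₗ
        ((FB n i).restrictScalars ℂ).subtype) := by
    rintro ⟨p, hp⟩ hpW
    exact Ideal.Quotient.eq_zero_iff_mem.mpr (sup_le (inf_le_left.trans (Jn_le_Iij n _ _))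
      (FB_le_Iij n _ _) hpW)
  refine ⟨Submodule.liftQ _ _ hφ,
    (Ideal.Quotient.factorₐ ℂ (Iij_succ_le n (n - i) i)).toLinearMap, fun p hp => rfl,
    fun P => rfl, ?_, Ideal.Quotient.factor_surjective (Iij_succ_le n (n - i) i), ?_⟩
  · rw [← LinearMap.ker_eq_bot, Submodule.ker_liftQ_eq_bot]
    rintro ⟨p, hp⟩ hpI
    exact FB_inf_Iij_le hi1 hin ⟨hp, Ideal.Quotient.eq_zero_iff_mem.mp hpI⟩
  · rw [Submodule.range_liftQ]
    ext q
    obtain ⟨P, rfl⟩ := Ideal.Quotient.mk_surjective q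
    constructor
    · rintro ⟨⟨p, hp⟩, h⟩
      rw [← h]
      exact Ideal.Quotient.eq_zero_iff_mem.mpr (FB_le_Iij n _ _ hp)
    · intro h
      have hP : P ∈ Iij n (n - i) i := Ideal.Quotient.eq_zero_iff_mem.mp h
      obtain ⟨a, ha, p, hp, rfl⟩ := Submodule.mem_sup.mp (Iij_le_sup_FB n _ _ hP)
      refine ⟨⟨p, hp⟩, Ideal.Quotient.eq.mpr ?_⟩
      simpa using ha

end
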